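/- Let m ≥ 1 be an integer, κ > 0, and set α = (2m+4+κ)/((m+1)κ), β = κα²/2 = (2m+4+κ)²/(2(m+1)²κ), and p = m(2m+4+κ)(2+κ)/(2(m+1)²κ). Then the function F(ζ,ω) = (1−ζ)^α (1−ω)^α (1−ζω)^{−β} (principal-branch powers) satisfies on 𝔻 × 𝔻 the m-fold Beliaev–Smirnov equation −(κ/2)(ζ∂_ζ − ω∂_ω)²F + ((ζ+1)/(ζ−1))·ζ∂_ζF + ((ω+1)/(ω−1))·ω∂_ωF + (p/m)((m−1)/(1−ζ) + (m−1)/(1−ω) − m/(1−ζ)² − m/(1−ω)² + 2)F = 0. (This is the analytic content of the theorem that the m-fold whole-plane SLE_κ map h₀^{(m)}(z) = z(f₀(z^m)/z^m)^{1/m} has E[|(h₀^{(m)})'(z)|^p] = (1−z^m)^α(1−z̄^m)^α(1−z^m z̄^m)^{−β} for this special exponent p.) -/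

import Mathlib

open Complex Metric Set

/-- `ζ ∂_ζ` acting on functions of two complex variables. -/
noncomputable def dZ (F : ℂ → ℂ → ℂ) : ℂ → ℂ → ℂ :=
  fun z w => z * deriv (fun t => F t w) z

/-- `ω ∂_ω` acting on functions of two complex variables. -/
noncomputable def dW (F : ℂ → ℂ → ℂ) : ℂ → ℂ → ℂ :=
  fun z w => w * deriv (fun t => F z t) w

/-- The `m`-fold Beliaev–Smirnov operator:
`−(κ/2)(ζ∂_ζ − ω∂_ω)²F + ((ζ+1)/(ζ−1)) ζ∂_ζF + ((ω+1)/(ω−1)) ω∂_ωF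
  + (p/m)((m−1)/(1−ζ) + (m−1)/(1−ω) − m/(1−ζ)² − m/(1−ω)² + 2)F`. -/
noncomputable def BSm (m : ℕ) (κ p : ℝ) (F : ℂ → ℂ → ℂ) : ℂ → ℂ → ℂ :=
  fun z w =>
    -((κ : ℂ)/2) * (dZ (fun u v => dZ F u v - dW F u v) z w
        - dW (fun u v => dZ F u v - dW F u v) z w)
      + ((z + 1)/(z - 1)) * dZ F z w
      + ((w + 1)/(w - 1)) * dW F z w
      + ((p : ℂ)/(m : ℂ)) * (((m : ℂ) - 1)/(1 - z) + ((m : ℂ) - 1)/(1 - w)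
          - (m : ℂ)/(1 - z)^2 - (m : ℂ)/(1 - w)^2 + 2) * F z w

/-- The function `(1 − u)^a (1 − v)^a (1 − uv)^{−b}`. -/
noncomputable def beliaevF (a b : ℂ) (u v : ℂ) : ℂ :=
  (1 - u) ^ a * (1 - v) ^ a * (1 - u * v) ^ (-b)

theorem beliaevF_comm (a b u v : ℂ) : beliaevF a b u v = beliaevF a b v u := by
  simp only [beliaevF]
  rw [mul_comm v u, mul_comm ((1 - v) ^ a)]

theorem one_sub_mem_slitPlane {z : ℂ} (hz : z ∈ ball (0 : ℂ) 1) : 1 - z ∈ slitPlane := by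
  rw [sub_eq_add_neg]
  exact mem_slitPlane_of_norm_lt_one (by simpa using hz)

theorem mul_mem_unit_ball {z w : ℂ} (hz : z ∈ ball (0 : ℂ) 1) (hw : w ∈ ball (0 : ℂ) 1) :
    z * w ∈ ball (0 : ℂ) 1 := by
  rw [mem_ball_zero_iff] at *
  rw [norm_mul]
  exact mul_lt_one_of_nonneg_of_lt_one_left (norm_nonneg z) hz hw.le

theorem hasDerivAt_beliaevF_left (a b : ℂ) {z w : ℂ} (hz : z ∈ ball (0 : ℂ) 1)
    (hw : w ∈ ball (0 : ℂ) 1) :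
    HasDerivAt (fun t => beliaevF a b t w)
      ((-a / (1 - z) + b * w / (1 - z * w)) * beliaevF a b z w) z := by
  have h1 := one_sub_mem_slitPlane hz
  have h2 := one_sub_mem_slitPlane (mul_mem_unit_ball hz hw)
  have h1' := slitPlane_ne_zero h1
  have h2' := slitPlane_ne_zero h2
  have d1 : HasDerivAt (fun t : ℂ => (1 - t) ^ a) _ z :=
    ((hasDerivAt_id z).const_sub 1).cpow_const h1
  have d2 : HasDerivAt (fun t : ℂ => (1 - t * w) ^ (-b)) _ z :=
    (((hasDerivAt_id z).mul_const w).const_sub 1).cpow_const h2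
  refine ((d1.mul_const ((1 - w) ^ a)).mul d2).congr_deriv ?_
  simp only [beliaevF, id]
  rw [cpow_sub _ _ h1', cpow_sub _ _ h2', cpow_one, cpow_one]
  field_simp

theorem hasDerivAt_beliaevF_right (a b : ℂ) {z w : ℂ} (hz : z ∈ ball (0 : ℂ) 1)
    (hw : w ∈ ball (0 : ℂ) 1) :
    HasDerivAt (fun t => beliaevF a b z t)
      ((-a / (1 - w) + b * z / (1 - z * w)) * beliaevF a b z w) w := by
  have h := hasDerivAt_beliaevF_left a b hw hz
  rw [mul_comm w z, beliaevF_comm a b w z] at h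
  exact h.congr_of_eventuallyEq (.of_forall fun t => beliaevF_comm a b z t)

theorem dZ_beliaevF (a b : ℂ) {z w : ℂ} (hz : z ∈ ball (0 : ℂ) 1) (hw : w ∈ ball (0 : ℂ) 1) :
    dZ (beliaevF a b) z w =
      z * ((-a / (1 - z) + b * w / (1 - z * w)) * beliaevF a b z w) := by
  rw [dZ, (hasDerivAt_beliaevF_left a b hz hw).deriv]

theorem dW_beliaevF (a b : ℂ) {z w : ℂ} (hz : z ∈ ball (0 : ℂ) 1) (hw : w ∈ ball (0 : ℂ) 1) :
    dW (beliaevF a b) z w =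
      w * ((-a / (1 - w) + b * z / (1 - z * w)) * beliaevF a b z w) := by
  rw [dW, (hasDerivAt_beliaevF_right a b hz hw).deriv]

theorem dZ_sub_dW_beliaevF (a b : ℂ) {z w : ℂ} (hz : z ∈ ball (0 : ℂ) 1)
    (hw : w ∈ ball (0 : ℂ) 1) :
    dZ (beliaevF a b) z w - dW (beliaevF a b) z w =
      (a * w / (1 - w) - a * z / (1 - z)) * beliaevF a b z w := by
  rw [dZ_beliaevF a b hz hw, dW_beliaevF a b hz hw]
  ring

theorem hasDerivAt_mul_div_one_sub (a : ℂ) {z : ℂ} (hz : 1 - z ≠ 0) :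
    HasDerivAt (fun t : ℂ => a * t / (1 - t)) (a / (1 - z) ^ 2) z := by
  refine (((hasDerivAt_id z).const_mul a).div ((hasDerivAt_id z).const_sub 1) hz).congr_deriv ?_
  simp only [id]
  ring

theorem dZ_dZ_sub_dW_beliaevF (a b : ℂ) {z w : ℂ} (hz : z ∈ ball (0 : ℂ) 1)
    (hw : w ∈ ball (0 : ℂ) 1) :
    dZ (fun u v => dZ (beliaevF a b) u v - dW (beliaevF a b) u v) z w =
      z * (-(a / (1 - z) ^ 2) + (a * w / (1 - w) - a * z / (1 - z)) *
        (-a / (1 - z) + b * w / (1 - z * w))) * beliaevF a b z w := by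
  have hd := (((hasDerivAt_mul_div_one_sub a
    (slitPlane_ne_zero (one_sub_mem_slitPlane hz))).const_sub (a * w / (1 - w))).mul
      (hasDerivAt_beliaevF_left a b hz hw)).congr_of_eventuallyEq
    (f₁ := fun t => dZ (beliaevF a b) t w - dW (beliaevF a b) t w)
    (by filter_upwards [isOpen_ball.mem_nhds hz] with t ht
        exact dZ_sub_dW_beliaevF a b ht hw)
  rw [dZ, hd.deriv]
  ring

theorem dW_dZ_sub_dW_beliaevF (a b : ℂ) {z w : ℂ} (hz : z ∈ ball (0 : ℂ) 1)
    (hw : w ∈ ball (0 : ℂ) 1) :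
    dW (fun u v => dZ (beliaevF a b) u v - dW (beliaevF a b) u v) z w =
      w * (a / (1 - w) ^ 2 + (a * w / (1 - w) - a * z / (1 - z)) *
        (-a / (1 - w) + b * z / (1 - z * w))) * beliaevF a b z w := by
  have hd := (((hasDerivAt_mul_div_one_sub a
    (slitPlane_ne_zero (one_sub_mem_slitPlane hw))).sub_const (a * z / (1 - z))).mul
      (hasDerivAt_beliaevF_right a b hz hw)).congr_of_eventuallyEq
    (f₁ := fun t => dZ (beliaevF a b) z t - dW (beliaevF a b) z t)
    (by filter_upwards [isOpen_ball.mem_nhds hw] with t ht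
        exact dZ_sub_dW_beliaevF a b hz ht)
  rw [dW, hd.deriv]
  ring

/-- The one-variable part of the Beliaev–Smirnov symbol of `(1 − z)^a (1 − w)^a (1 − zw)^{−b}`
vanishes as soon as its coefficients of `z` and `z²` do. -/
theorem one_variable_symbol_eq_zero {k a q m z : ℂ} (hz : 1 - z ≠ 0)
    (h1 : k * a / 2 + a - q * (m + 1) = 0) (h2 : -(k * a ^ 2 / 2) + a + q = 0) :
    -(k / 2) * ((a * z / (1 - z)) ^ 2 - a * z / (1 - z) ^ 2)
      + (z + 1) / (z - 1) * (-(a * z / (1 - z)))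
      + q * ((m - 1) / (1 - z) - m / (1 - z) ^ 2 + 1) = 0 := by
  rw [← neg_sub 1 z]
  field_simp
  linear_combination 2 * z * h1 + 2 * z ^ 2 * h2

/-- The mixed part of the symbol vanishes for `b = k a² / 2`. -/
theorem mixed_symbol_eq_zero {k a b z w : ℂ} (hz : 1 - z ≠ 0) (hw : 1 - w ≠ 0)
    (hzw : 1 - z * w ≠ 0) (hb : b = k * a ^ 2 / 2) :
    k * (a * z / (1 - z)) * (a * w / (1 - w))
      + ((z + 1) / (z - 1) + (w + 1) / (w - 1)) * (b * z * w / (1 - z * w)) = 0 := by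
  rw [← neg_sub 1 z, ← neg_sub 1 w, hb]
  field_simp
  ring

/-- For an integer `m ≥ 1`, `κ > 0`, `α = (2m+4+κ)/((m+1)κ)`, `β = κα²/2`,
`p = m(2m+4+κ)(2+κ)/(2(m+1)²κ)`, the function `F(ζ,ω) = (1−ζ)^α (1−ω)^α (1−ζω)^{−β}`
satisfies the `m`-fold Beliaev–Smirnov equation on `𝔻 × 𝔻`. -/
theorem stmt5 (m : ℕ) (hm : 1 ≤ m) (κ : ℝ) (hκ : 0 < κ) :
    let α : ℝ := (2*(m:ℝ) + 4 + κ)/(((m:ℝ) + 1)*κ)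
    let β : ℝ := κ * α^2/2
    let p : ℝ := (m:ℝ)*(2*(m:ℝ) + 4 + κ)*(2 + κ)/(2*((m:ℝ) + 1)^2*κ)
    let F : ℂ → ℂ → ℂ := fun u v =>
      (1 - u) ^ (α : ℂ) * (1 - v) ^ (α : ℂ) * (1 - u*v) ^ (-(β : ℂ))
    ∀ z ∈ ball (0:ℂ) 1, ∀ w ∈ ball (0:ℂ) 1, BSm m κ p F z w = 0 := by
  intro α β p F z hz w hw
  have hz' := slitPlane_ne_zero (one_sub_mem_slitPlane hz)
  have hw' := slitPlane_ne_zero (one_sub_mem_slitPlane hw)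
  have hzw' := slitPlane_ne_zero (one_sub_mem_slitPlane (mul_mem_unit_ball hz hw))
  have hF : F = beliaevF α β := rfl
  have hm0 : (m : ℂ) ≠ 0 := by exact_mod_cast (by omega : m ≠ 0)
  have hm1 : (m : ℂ) + 1 ≠ 0 := by exact_mod_cast m.succ_ne_zero
  have hκ0 : (κ : ℂ) ≠ 0 := by exact_mod_cast hκ.ne'
  have hβ : (β : ℂ) = κ * (α : ℂ) ^ 2 / 2 := by simp only [β]; push_cast; ring
  have h1 : (κ : ℂ) * α / 2 + α - p / m * (m + 1) = 0 := by
    simp only [α, p]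
    push_cast
    field_simp
    ring
  have h2 : -((κ : ℂ) * (α : ℂ) ^ 2 / 2) + α + p / m = 0 := by
    simp only [α, p]
    push_cast
    field_simp
    ring
  rw [BSm, hF, dZ_dZ_sub_dW_beliaevF _ _ hz hw, dW_dZ_sub_dW_beliaevF _ _ hz hw,
    dZ_beliaevF _ _ hz hw, dW_beliaevF _ _ hz hw]
  linear_combination beliaevF α β z w * (one_variable_symbol_eq_zero hz' h1 h2
    + one_variable_symbol_eq_zero hw' h1 h2 + mixed_symbol_eq_zero hz' hw' hzw' hβ)
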